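/- Let q > b ≥ 1 be integers and let G be a coloured graph on n vertices with δ(G) > (2 − 12/(3q+3b−5))·n that contains BK_q as a subgraph. Then BK_{q+1} is a subgraph of G or G_{q+b,b} is a subgraph of G. -/

import Mathlib

/-- A coloured graph structure on a weight function: symmetric, `{0,1,2}`-valued,
vanishing on the diagonal. -/
def IsColoured {V : Type*} (w : V → V → ℕ) : Prop :=
  (∀ x y, w x y = w y x) ∧ (∀ x y, w x y ≤ 2) ∧ (∀ x, w x x = 0)

/-- The coloured graph with weight function `f` on `Fin m` is a subgraph of `(V, w)`. -/
def HasSub {V : Type*} (w : V → V → ℕ) {m : ℕ} (f : Fin m → Fin m → ℕ) : Prop :=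
  ∃ φ : Fin m → V, Function.Injective φ ∧ ∀ x y, f x y ≤ w (φ x) (φ y)

/-- The red clique `RK_m`: every edge has weight `2`. -/
def RK (m : ℕ) : Fin m → Fin m → ℕ := fun x y => if x = y then 0 else 2

/-- The blue clique `BK_m`: every edge has weight `1`. -/
def BK (m : ℕ) : Fin m → Fin m → ℕ := fun x y => if x = y then 0 else 1

/-- The coloured graph `G_{t,i}` of order `t - i`: a red clique `RK_i` (the first `i`
vertices) and a blue clique `BK_{t-2i}`, joined by edges of weight `1`. -/
def Gt (t i : ℕ) : Fin (t - i) → Fin (t - i) → ℕ :=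
  fun x y => if x = y then 0 else if x.val < i ∧ y.val < i then 2 else 1

/-- `(V, w)` is `𝓕_t`-free, where `𝓕_t = {G_{t,i} : 1 ≤ i ≤ t/2}`. -/
def FamFree {V : Type*} (w : V → V → ℕ) (t : ℕ) : Prop :=
  ∀ i, 1 ≤ i → 2 * i ≤ t → ¬ HasSub w (Gt t i)

section BlueClique

variable {V : Type*}

/-- A clique for the missing weight `m`: distinct vertices miss weight at most `1`. -/
def IsBlueClique (m : V → V → ℕ) (K : Finset V) : Prop :=
  ∀ a ∈ K, ∀ b ∈ K, a ≠ b → m a b ≤ 1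

/-- A red clique for the missing weight `m`: distinct vertices miss no weight. -/
def IsRedClique (m : V → V → ℕ) (R : Finset V) : Prop :=
  ∀ a ∈ R, ∀ b ∈ R, a ≠ b → m a b = 0

variable [DecidableEq V]

/-- The missing weight between `R` and the rest of `K`. -/
def crossMissing (m : V → V → ℕ) (K R : Finset V) : ℕ :=
  ∑ z ∈ K \ R, ∑ x ∈ R, m x z

/-- `K` is a maximum blue clique and `R ⊆ K` is a red clique, chosen to be as large as possible
among all such pairs, and then with as little missing weight to `K \ R` as possible. -/
structure IsExtremalPair (m : V → V → ℕ) (K R : Finset V) : Prop where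
  symm : ∀ x y, m x y = m y x
  le_two : ∀ x y, m x y ≤ 2
  self : ∀ x, m x x = 2
  sub : R ⊆ K
  blue : IsBlueClique m K
  red : IsRedClique m R
  card_le : ∀ K', IsBlueClique m K' → K'.card ≤ K.card
  red_card_le : ∀ K' R', R' ⊆ K' → K'.card = K.card → IsBlueClique m K' → IsRedClique m R' →
    R'.card ≤ R.card
  cross_le : ∀ K' R', R' ⊆ K' → K'.card = K.card → IsBlueClique m K' → IsRedClique m R' →
    R'.card = R.card → crossMissing m K R ≤ crossMissing m K' R'

omit [DecidableEq V] in
lemma IsBlueClique.mono {m : V → V → ℕ} {K L : Finset V} (h : IsBlueClique m K) (hL : L ⊆ K) :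
    IsBlueClique m L :=
  fun a ha b hb => h a (hL ha) b (hL hb)

omit [DecidableEq V] in
lemma IsRedClique.mono {m : V → V → ℕ} {K L : Finset V} (h : IsRedClique m K) (hL : L ⊆ K) :
    IsRedClique m L :=
  fun a ha b hb => h a (hL ha) b (hL hb)

lemma IsBlueClique.insert {m : V → V → ℕ} (hs : ∀ x y, m x y = m y x) {K : Finset V} {y : V}
    (h : IsBlueClique m K) (hy : ∀ x ∈ K, m x y ≤ 1) : IsBlueClique m (insert y K) := by
  intro a ha b hb hab
  rcases Finset.mem_insert.1 ha with ha' | ha' <;> rcases Finset.mem_insert.1 hb with hb' | hb'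
  · exact absurd (ha'.trans hb'.symm) hab
  · rw [hs, ha']; exact hy b hb'
  · rw [hb']; exact hy a ha'
  · exact h a ha' b hb' hab

lemma IsRedClique.insert {m : V → V → ℕ} (hs : ∀ x y, m x y = m y x) {K : Finset V} {y : V}
    (h : IsRedClique m K) (hy : ∀ x ∈ K, m x y = 0) : IsRedClique m (insert y K) := by
  intro a ha b hb hab
  rcases Finset.mem_insert.1 ha with ha' | ha' <;> rcases Finset.mem_insert.1 hb with hb' | hb'
  · exact absurd (ha'.trans hb'.symm) hab
  · rw [hs, ha']; exact hy b hb'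
  · rw [hb']; exact hy a ha'
  · exact h a ha' b hb' hab

namespace IsExtremalPair

variable {m : V → V → ℕ} {K R : Finset V}

lemma exists_nonadj (h : IsExtremalPair m K R) (y : V) :
    (∃ a ∈ K, ∃ b ∈ K, a ≠ b ∧ m a y = 2 ∧ m b y = 2) ∨
      ∃ a ∈ K, m a y = 2 ∧ ∀ x ∈ K, x ≠ a → m x y ≤ 1 := by
  have key : ∃ a ∈ K, m a y = 2 := by
    by_contra! hne
    have hle : ∀ x ∈ K, m x y ≤ 1 := fun x hx => by
      have := h.le_two x y
      have := hne x hx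
      omega
    have hy : y ∉ K := fun hy => hne y hy (h.self y)
    have := h.card_le _ (h.blue.insert h.symm hle)
    rw [Finset.card_insert_of_notMem hy] at this
    omega
  obtain ⟨a, ha, hay⟩ := key
  by_cases hb : ∃ b ∈ K, b ≠ a ∧ m b y = 2
  · obtain ⟨b, hb, hba, hby⟩ := hb
    exact Or.inl ⟨a, ha, b, hb, hba.symm, hay, hby⟩
  · push Not at hb
    refine Or.inr ⟨a, ha, hay, fun x hx hxa => ?_⟩
    have := h.le_two x y
    have := hb x hx hxa
    omega

lemma notMem_erase (h : IsExtremalPair m K R) {a y : V}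
    (hy : ∀ x ∈ K, x ≠ a → m x y ≤ 1) : y ∉ K.erase a := by
  intro hmem
  have := hy y (Finset.mem_of_mem_erase hmem) (Finset.ne_of_mem_erase hmem)
  rw [h.self] at this
  omega

lemma blue_swap (h : IsExtremalPair m K R) {a y : V}
    (hy : ∀ x ∈ K, x ≠ a → m x y ≤ 1) : IsBlueClique m (insert y (K.erase a)) :=
  (h.blue.mono (K.erase_subset a)).insert h.symm fun x hx =>
    hy x (Finset.mem_of_mem_erase hx) (Finset.ne_of_mem_erase hx)

lemma card_swap (h : IsExtremalPair m K R) {a y : V} (ha : a ∈ K)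
    (hy : ∀ x ∈ K, x ≠ a → m x y ≤ 1) : (insert y (K.erase a)).card = K.card := by
  rw [Finset.card_insert_of_notMem (h.notMem_erase hy), Finset.card_erase_add_one ha]

lemma exists_blue (h : IsExtremalPair m K R) {a y : V} (ha : a ∈ K)
    (hy : ∀ x ∈ K, x ≠ a → m x y ≤ 1) {S : Finset V} (hS : S ⊆ K) (hred : IsRedClique m S)
    (hcard : S.card = R.card) (haS : a ∉ S) : ∃ x ∈ S, 1 ≤ m x y := by
  by_contra! hne
  have hsub : S ⊆ K.erase a := fun x hx =>
    Finset.mem_erase.2 ⟨fun e => haS (e ▸ hx), hS hx⟩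
  have := h.red_card_le _ (insert y S) (Finset.insert_subset_insert y hsub) (h.card_swap ha hy)
    (h.blue_swap hy) (hred.insert h.symm fun x hx => by have := hne x hx; omega)
  rw [Finset.card_insert_of_notMem fun hm => h.notMem_erase hy (hsub hm)] at this
  omega

lemma sum_le_sum_of_swap (h : IsExtremalPair m K R) {a y : V} (ha : a ∈ K)
    (hy : ∀ x ∈ K, x ≠ a → m x y ≤ 1) (haR : a ∉ R) :
    ∑ x ∈ R, m x a ≤ ∑ x ∈ R, m x y := by
  have hsub : R ⊆ K.erase a := fun x hx =>
    Finset.mem_erase.2 ⟨fun e => haR (e ▸ hx), h.sub hx⟩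
  have hyK := h.notMem_erase hy
  have hyR : y ∉ R := fun hm => hyK (hsub hm)
  have hle := h.cross_le _ R (hsub.trans (Finset.subset_insert _ _)) (h.card_swap ha hy)
    (h.blue_swap hy) h.red rfl
  have e1 : insert y (K.erase a) \ R = insert y ((K \ R).erase a) := by
    rw [Finset.insert_sdiff_of_notMem _ hyR, Finset.erase_sdiff_comm]
  have hy' : y ∉ (K \ R).erase a := fun hm =>
    hyK (Finset.erase_subset_erase a Finset.sdiff_subset hm)
  unfold crossMissing at hle
  rw [e1, Finset.sum_insert hy',
    ← Finset.add_sum_erase (K \ R) _ (Finset.mem_sdiff.2 ⟨ha, haR⟩)] at hle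
  omega

lemma exists_blue_of_mem (h : IsExtremalPair m K R) {a y z : V} (ha : a ∈ R)
    (hy : ∀ x ∈ K, x ≠ a → m x y ≤ 1) (hz : z ∈ K \ R) (haz : 1 ≤ m a z) :
    ∃ x ∈ K, x ≠ a ∧ 1 ≤ m x y := by
  by_contra! hne
  have haK := h.sub ha
  have hsub : R.erase a ⊆ K.erase a := Finset.erase_subset_erase a h.sub
  have hyK := h.notMem_erase hy
  have hyR : y ∉ R.erase a := fun hm => hyK (hsub hm)
  have hzero : ∀ x ∈ K, x ≠ a → m x y = 0 := fun x hx hxa => by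
    have := hne x hx hxa
    omega
  have hred : IsRedClique m (insert y (R.erase a)) :=
    (h.red.mono (R.erase_subset a)).insert h.symm fun x hx =>
      hzero x (h.sub (Finset.mem_of_mem_erase hx)) (Finset.ne_of_mem_erase hx)
  have hle := h.cross_le _ _ (Finset.insert_subset_insert y hsub) (h.card_swap haK hy)
    (h.blue_swap hy) hred
    (by rw [Finset.card_insert_of_notMem hyR, Finset.card_erase_add_one ha])
  have e1 : insert y (K.erase a) \ insert y (R.erase a) = K \ R := by
    ext v
    simp only [Finset.mem_sdiff, Finset.mem_insert, Finset.mem_erase]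
    by_cases hv : v = a
    · subst hv; simp [ha]
    · by_cases hvy : v = y
      · subst hvy
        have : v ∉ K := fun hm => hyK (Finset.mem_erase.2 ⟨hv, hm⟩)
        simp [this]
      · simp [hv, hvy]
  unfold crossMissing at hle
  rw [e1] at hle
  have hyv : ∀ v ∈ K \ R, m y v = 0 := fun v hv => by
    rw [h.symm]
    exact hzero v (Finset.mem_sdiff.1 hv).1 fun e => (Finset.mem_sdiff.1 hv).2 (e ▸ ha)
  refine absurd hle (not_le.2 (Finset.sum_lt_sum (fun v hv => ?_) ⟨z, hz, ?_⟩))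
  · rw [Finset.sum_insert hyR, ← Finset.add_sum_erase R _ ha, hyv v hv]
    omega
  · rw [Finset.sum_insert hyR, ← Finset.add_sum_erase R _ ha, hyv z hz]
    omega

lemma red_swap (h : IsExtremalPair m K R) {x z : V}
    (hp : ∀ v ∈ R, v ≠ x → m v z = 0) : IsRedClique m (insert z (R.erase x)) :=
  (h.red.mono (R.erase_subset x)).insert h.symm fun v hv =>
    hp v (Finset.mem_of_mem_erase hv) (Finset.ne_of_mem_erase hv)

lemma exists_blue_red_swap (h : IsExtremalPair m K R) {x z a y : V} (hx : x ∈ R) (hz : z ∈ K \ R)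
    (hp : ∀ v ∈ R, v ≠ x → m v z = 0) (ha : a ∈ K)
    (hy : ∀ v ∈ K, v ≠ a → m v y ≤ 1) (haz : a ≠ z) (haR : a = x ∨ a ∉ R) :
    ∃ v ∈ K, v ≠ a ∧ 1 ≤ m v y ∧ (v = z ∨ (v ∈ R ∧ v ≠ x)) := by
  have hz' := Finset.mem_sdiff.1 hz
  have haS : a ∉ insert z (R.erase x) := by
    simp only [Finset.mem_insert, Finset.mem_erase, not_or, not_and]
    refine ⟨haz, fun hax => ?_⟩
    rcases haR with rfl | haR
    · exact absurd rfl hax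
    · exact haR
  have hsub : insert z (R.erase x) ⊆ K :=
    Finset.insert_subset hz'.1 ((R.erase_subset x).trans h.sub)
  obtain ⟨v, hv, hvy⟩ := h.exists_blue ha hy hsub (h.red_swap hp)
    (by rw [Finset.card_insert_of_notMem fun hm => hz'.2 (Finset.mem_of_mem_erase hm),
      Finset.card_erase_add_one hx]) haS
  refine ⟨v, hsub hv, fun e => haS (e ▸ hv), hvy, ?_⟩
  rcases Finset.mem_insert.1 hv with e | hv
  · exact Or.inl e
  · exact Or.inr ⟨Finset.mem_of_mem_erase hv, Finset.ne_of_mem_erase hv⟩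

lemma exists_blue_red (h : IsExtremalPair m K R) {a y : V} (ha : a ∈ K)
    (hy : ∀ v ∈ K, v ≠ a → m v y ≤ 1) (haR : a ∉ R) :
    ∃ v ∈ R, v ∈ K ∧ v ≠ a ∧ 1 ≤ m v y := by
  obtain ⟨v, hv, hvy⟩ := h.exists_blue ha hy h.sub h.red rfl haR
  exact ⟨v, hv, h.sub hv, fun e => haR (e ▸ hv), hvy⟩

lemma exists_two_blue_of_sum (h : IsExtremalPair m K R) {a y : V} (haR : a ∉ R)
    (hy : ∀ v ∈ K, v ≠ a → m v y ≤ 1) (hsum : 2 ≤ ∑ v ∈ R, m v y) :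
    ∃ v ∈ R, ∃ u ∈ R, v ≠ u ∧ 1 ≤ m v y ∧ 1 ≤ m u y := by
  have hle : ∀ v ∈ R, m v y ≤ 1 := fun v hv => hy v (h.sub hv) fun e => haR (e ▸ hv)
  have hcard : 1 < (R.filter fun v => 1 ≤ m v y).card := by
    rw [Finset.card_filter]
    refine lt_of_lt_of_le hsum (Finset.sum_le_sum fun v hv => ?_)
    have := hle v hv
    split_ifs <;> omega
  obtain ⟨v, hv, u, hu, hvu⟩ := Finset.one_lt_card.1 hcard
  rw [Finset.mem_filter] at hv hu
  exact ⟨v, hv.1, u, hu.1, hvu, hv.2, hu.2⟩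

lemma exists_two_blue_self (h : IsExtremalPair m K R) {z : V} (hz : z ∈ K \ R)
    (hnp : ¬ ∃ x ∈ R, ∀ v ∈ R, v ≠ x → m v z = 0) :
    ∃ v ∈ R, ∃ u ∈ R, v ≠ u ∧ 1 ≤ m v z ∧ 1 ≤ m u z := by
  obtain ⟨hzK, hzR⟩ := Finset.mem_sdiff.1 hz
  push Not at hnp
  obtain ⟨x, hx, -, -, hxz⟩ := h.exists_blue_red (y := z) hzK
    (fun v hv hvz => h.blue v hv z hzK hvz) hzR
  obtain ⟨u, hu, hux, huz⟩ := hnp x hx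
  exact ⟨x, hx, u, hu, hux.symm, hxz, Nat.one_le_iff_ne_zero.2 huz⟩

lemma exists_two_blue (h : IsExtremalPair m K R) {a y : V} (ha : a ∈ K)
    (hy : ∀ v ∈ K, v ≠ a → m v y ≤ 1) (haR : a ∉ R)
    (hnp : ¬ ∃ x ∈ R, ∀ v ∈ R, v ≠ x → m v a = 0) :
    ∃ v ∈ R, ∃ u ∈ R, v ≠ u ∧ 1 ≤ m v y ∧ 1 ≤ m u y := by
  obtain ⟨v, hv, u, hu, hvu, hva, hua⟩ :=
    h.exists_two_blue_self (Finset.mem_sdiff.2 ⟨ha, haR⟩) hnp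
  refine h.exists_two_blue_of_sum haR hy (le_trans ?_ (h.sum_le_sum_of_swap ha hy haR))
  have := Finset.add_le_sum (s := R) (f := fun v => m v a) (fun _ _ => Nat.zero_le _) hv hu hvu
  omega

/-- A vertex weighting on `K` certifies a lower bound as soon as every vertex `y` with a unique
nonneighbour `a` in `K` sees enough further missing weight. -/
lemma weight_ok (h : IsExtremalPair m K R) (c : V → ℕ) (hc : ∀ v ∈ K, 3 ≤ c v)
    (hone : ∀ y, ∀ a ∈ K, m a y = 2 → (∀ v ∈ K, v ≠ a → m v y ≤ 1) →
      6 ≤ c a ∨ (∃ v ∈ K, v ≠ a ∧ 1 ≤ m v y ∧ 12 ≤ 2 * c a + c v) ∨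
      ∃ v ∈ K, ∃ u ∈ K, v ≠ a ∧ u ≠ a ∧ v ≠ u ∧ 1 ≤ m v y ∧ 1 ≤ m u y ∧
        12 ≤ 2 * c a + c v + c u) (y : V) :
    12 ≤ ∑ v ∈ K, c v * m v y := by
  have two : ∀ a ∈ K, ∀ b ∈ K, a ≠ b → c a * m a y + c b * m b y ≤ ∑ v ∈ K, c v * m v y :=
    fun a ha b hb hab =>
      Finset.add_le_sum (f := fun v => c v * m v y) (fun _ _ => Nat.zero_le _) ha hb hab
  have hmul : ∀ v, 1 ≤ m v y → c v ≤ c v * m v y := fun v hv => Nat.le_mul_of_pos_right _ hv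
  rcases h.exists_nonadj y with ⟨a, ha, b, hb, hab, hay, hby⟩ | ⟨a, ha, hay, hy⟩
  · have := two a ha b hb hab
    have := hc a ha
    have := hc b hb
    rw [hay, hby] at *
    omega
  · rcases hone y a ha hay hy with h6 | ⟨v, hv, hva, hvy, h12⟩ |
      ⟨v, hv, u, hu, hva, hua, hvu, hvy, huy, h12⟩
    · have := Finset.single_le_sum (f := fun v => c v * m v y) (fun _ _ => Nat.zero_le _) ha
      simp only [hay] at this
      omega
    · have := two a ha v hv hva.symm
      have := hmul v hvy
      rw [hay] at *
      omega
    · have hsub : ({a, v, u} : Finset V) ⊆ K := by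
        intro t ht
        simp only [Finset.mem_insert, Finset.mem_singleton] at ht
        rcases ht with rfl | rfl | rfl <;> assumption
      have := Finset.sum_le_sum_of_subset (f := fun v => c v * m v y) hsub
      rw [Finset.sum_insert (by simp [hva.symm, hua.symm]), Finset.sum_pair hvu, hay] at this
      have := hmul v hvy
      have := hmul u huy
      omega

/-- The weighting with value `6` on `R` and `3` on `K \ R`. -/
lemma sum_base (h : IsExtremalPair m K R) :
    ∑ v ∈ K, (if v ∈ R then 6 else 3) = 3 * K.card + 3 * R.card := by
  have : ∀ v ∈ K, (if v ∈ R then 6 else 3) = 3 + if v ∈ R then 3 else 0 := fun v _ => by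
    split_ifs <;> rfl
  rw [Finset.sum_congr rfl this, Finset.sum_add_distrib, Finset.sum_const, Finset.sum_ite_mem,
    Finset.inter_eq_right.2 h.sub, Finset.sum_const]
  simp only [smul_eq_mul]
  ring

lemma exists_weight_of_shared (h : IsExtremalPair m K R) {x z₁ z₂ : V} (hx : x ∈ R)
    (hz₁ : z₁ ∈ K \ R) (hz₂ : z₂ ∈ K \ R) (hz : z₁ ≠ z₂)
    (hp₁ : ∀ v ∈ R, v ≠ x → m v z₁ = 0) (hp₂ : ∀ v ∈ R, v ≠ x → m v z₂ = 0) :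
    ∃ c : V → ℕ, ∑ v ∈ K, c v + 2 ≤ 3 * K.card + 3 * R.card ∧
      ∀ y, 12 ≤ ∑ v ∈ K, c v * m v y := by
  have hK := h.sub hx
  rw [Finset.mem_sdiff] at *
  obtain ⟨c, hc⟩ : ∃ c : V → ℕ, ∀ v, c v =
      if v = x then 3 else if v ∈ R then 6 else 3 :=
    ⟨_, fun _ => rfl⟩
  have hc3 : ∀ v, 3 ≤ c v := by grind
  have hcx : c x = 3 := by grind
  have hcR : ∀ v ∈ R, v ≠ x → c v = 6 := by grind
  refine ⟨c, ?_, h.weight_ok c (fun v _ => hc3 v) fun y a ha hay hy => ?_⟩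
  · have e : ∀ v ∈ K, c v + (if v = x then 3 else 0) = if v ∈ R then 6 else 3 := by grind
    have e' := Finset.sum_congr rfl e
    rw [h.sum_base, Finset.sum_add_distrib, Finset.sum_ite_eq', if_pos hK] at e'
    omega
  · have f₀ := h.exists_blue_red ha hy
    have f₁ := h.exists_blue_red_swap hx (Finset.mem_sdiff.2 hz₁) hp₁ ha hy
    have f₂ := h.exists_blue_red_swap hx (Finset.mem_sdiff.2 hz₂) hp₂ ha hy
    clear hc hp₁ hp₂
    have hc₁ := hc3 z₁
    have hc₂ := hc3 z₂
    have hca := hc3 a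
    by_cases haR : a = x ∨ a ∉ R
    · by_cases h₁ : a = z₁
      · obtain ⟨v, hv, hva, hvy, hv'⟩ := f₂ (h₁ ▸ hz) haR
        obtain ⟨u, hu, huK, hua, huy⟩ := f₀ (h₁ ▸ hz₁.2)
        grind
      · obtain ⟨v, hv, hva, hvy, hv'⟩ := f₁ h₁ haR
        by_cases h₂ : a = z₂
        · obtain ⟨u, hu, huK, hua, huy⟩ := f₀ (h₂ ▸ hz₂.2)
          grind
        · obtain ⟨u, hu, hua, huy, hu'⟩ := f₂ h₂ haR
          grind
    · grind

lemma exists_weight_of_disjoint (h : IsExtremalPair m K R) {x₁ x₂ z₁ z₂ : V} (hx₁ : x₁ ∈ R)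
    (hx₂ : x₂ ∈ R) (hz₁ : z₁ ∈ K \ R) (hz₂ : z₂ ∈ K \ R) (hx : x₁ ≠ x₂) (hz : z₁ ≠ z₂)
    (hp₁ : ∀ v ∈ R, v ≠ x₁ → m v z₁ = 0) (hp₂ : ∀ v ∈ R, v ≠ x₂ → m v z₂ = 0) :
    ∃ c : V → ℕ, ∑ v ∈ K, c v + 2 ≤ 3 * K.card + 3 * R.card ∧
      ∀ y, 12 ≤ ∑ v ∈ K, c v * m v y := by
  have hK₁ := h.sub hx₁
  have hK₂ := h.sub hx₂
  rw [Finset.mem_sdiff] at *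
  obtain ⟨c, hc⟩ : ∃ c : V → ℕ, ∀ v, c v =
      if v = x₁ ∨ v = x₂ ∨ v = z₁ ∨ v = z₂ then 4 else if v ∈ R then 6 else 3 :=
    ⟨_, fun _ => rfl⟩
  have hc3 : ∀ v, 3 ≤ c v := by grind
  have hcR : ∀ v ∈ R, 4 ≤ c v := by grind
  have hcR' : ∀ v ∈ R, v ≠ x₁ → v ≠ x₂ → c v = 6 := by grind
  have hcz : c x₁ = 4 ∧ c x₂ = 4 ∧ c z₁ = 4 ∧ c z₂ = 4 := by grind
  refine ⟨c, ?_, h.weight_ok c (fun v _ => hc3 v) fun y a ha hay hy => ?_⟩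
  · have e : ∀ v ∈ K, c v + ((if v = x₁ then 2 else 0) + (if v = x₂ then 2 else 0)) =
        (if v ∈ R then 6 else 3) + ((if v = z₁ then 1 else 0) + (if v = z₂ then 1 else 0)) := by
      grind
    have e' := Finset.sum_congr rfl e
    simp only [Finset.sum_add_distrib, h.sum_base, Finset.sum_ite_eq', hK₁, hK₂, hz₁.1, hz₂.1,
      if_true] at e'
    omega
  · have f₀ := h.exists_blue_red ha hy
    have f₁ := h.exists_blue_red_swap hx₁ (Finset.mem_sdiff.2 hz₁) hp₁ ha hy
    have f₂ := h.exists_blue_red_swap hx₂ (Finset.mem_sdiff.2 hz₂) hp₂ ha hy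
    clear hc hp₁ hp₂
    have hca := hc3 a
    by_cases haR : a ∈ R
    · by_cases h₁ : a = x₁
      · obtain ⟨v, hv, hva, hvy, hv'⟩ := f₁ (by grind) (Or.inl h₁)
        grind
      · by_cases h₂ : a = x₂
        · obtain ⟨v, hv, hva, hvy, hv'⟩ := f₂ (by grind) (Or.inl h₂)
          grind
        · grind
    · by_cases haz : a = z₁ ∨ a = z₂
      · obtain ⟨u, hu, huK, hua, huy⟩ := f₀ haR
        grind
      · push Not at haz
        obtain ⟨v, hv, hva, hvy, hv'⟩ := f₁ haz.1 (Or.inr haR)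
        obtain ⟨u, hu, hua, huy, hu'⟩ := f₂ haz.2 (Or.inr haR)
        have hvu : v ≠ u ∨ 6 ≤ c v := by grind
        have hv4 : 4 ≤ c v := by grind
        have hu4 : 4 ≤ c u := by grind
        rcases hvu with hvu | h6
        · exact Or.inr (Or.inr ⟨v, hv, u, hu, hva, hua, hvu, hvy, huy, by omega⟩)
        · exact Or.inr (Or.inl ⟨v, hv, hva, hvy, by omega⟩)

lemma exists_weight_of_single (h : IsExtremalPair m K R) {x x' z z' : V} (hx : x ∈ R)
    (hx' : x' ∈ R) (hxx : x ≠ x') (hz : z ∈ K \ R) (hz' : z' ∈ K \ R)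
    (hp : ∀ v ∈ R, v ≠ x → m v z = 0) (hxz : 1 ≤ m x' z')
    (hnp : ∀ t ∈ K \ R, t ≠ z → ¬ ∃ x ∈ R, ∀ v ∈ R, v ≠ x → m v t = 0) :
    ∃ c : V → ℕ, ∑ v ∈ K, c v + 2 ≤ 3 * K.card + 3 * R.card ∧
      ∀ y, 12 ≤ ∑ v ∈ K, c v * m v y := by
  have hK := h.sub hx
  have hK' := h.sub hx'
  have g := fun y hy => h.exists_blue_of_mem (y := y) hx' hy hz' hxz
  rw [Finset.mem_sdiff] at hz
  obtain ⟨c, hc⟩ : ∃ c : V → ℕ, ∀ v, c v =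
      if v = x ∨ v = z then 4 else if v = x' then 5 else if v ∈ R then 6 else 3 :=
    ⟨_, fun _ => rfl⟩
  have hc3 : ∀ v, 3 ≤ c v := by grind
  have hcR : ∀ v ∈ R, 4 ≤ c v := by grind
  have hcR' : ∀ v ∈ R, v ≠ x → 5 ≤ c v := by grind
  refine ⟨c, ?_, h.weight_ok c (fun v _ => hc3 v) fun y a ha hay hy => ?_⟩
  · have e : ∀ v ∈ K, c v + ((if v = x then 2 else 0) + (if v = x' then 1 else 0)) =
        (if v ∈ R then 6 else 3) + (if v = z then 1 else 0) := by
      grind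
    have e' := Finset.sum_congr rfl e
    simp only [Finset.sum_add_distrib, h.sum_base, Finset.sum_ite_eq', hK, hK', hz.1,
      if_true] at e'
    omega
  · have f₀ := h.exists_blue_red ha hy
    have f₁ := h.exists_blue_red_swap hx (Finset.mem_sdiff.2 hz) hp ha hy
    have hca := hc3 a
    by_cases haR : a ∈ R
    · by_cases hax : a = x'
      · obtain ⟨v, hv, hva, hvy⟩ := g y fun v hv hva => hy v hv (hax ▸ hva)
        have := hc3 v
        have : c a = 5 := by grind
        exact Or.inr (Or.inl ⟨v, hv, hax ▸ hva, hvy, by omega⟩)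
      · by_cases hax : a = x
        · obtain ⟨v, hv, hva, hvy, hv'⟩ := f₁ (by grind) (Or.inl hax)
          have : 4 ≤ c v := by grind
          have : c a = 4 := by grind
          exact Or.inr (Or.inl ⟨v, hv, hva, hvy, by omega⟩)
        · have : c a = 6 := by grind
          exact Or.inl this.ge
    · by_cases haz : a = z
      · obtain ⟨v, hvR, hv, hva, hvy⟩ := f₀ haR
        have := hcR v hvR
        have : c a = 4 := by grind
        exact Or.inr (Or.inl ⟨v, hv, hva, hvy, by omega⟩)
      · obtain ⟨v, hv, u, hu, hvu, hvy, huy⟩ :=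
          h.exists_two_blue ha hy haR (hnp a (Finset.mem_sdiff.2 ⟨ha, haR⟩) haz)
        have : 9 ≤ c v + c u := by
          have := hcR v hv
          have := hcR u hu
          by_cases hvx : v = x
          · have := hcR' u hu fun e => hvu (hvx.trans e.symm)
            omega
          · have := hcR' v hv hvx
            omega
        exact Or.inr (Or.inr ⟨v, h.sub hv, u, h.sub hu, fun e => haR (e ▸ hv),
          fun e => haR (e ▸ hu), hvu, hvy, huy, by omega⟩)

lemma exists_weight_of_none (h : IsExtremalPair m K R) {x x' z : V} (hx : x ∈ R)
    (hx' : x' ∈ R) (hxx : x ≠ x') (hz : z ∈ K \ R) (hxz : 1 ≤ m x z) (hxz' : 1 ≤ m x' z)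
    (hnp : ∀ t ∈ K \ R, ¬ ∃ x ∈ R, ∀ v ∈ R, v ≠ x → m v t = 0) :
    ∃ c : V → ℕ, ∑ v ∈ K, c v + 2 ≤ 3 * K.card + 3 * R.card ∧
      ∀ y, 12 ≤ ∑ v ∈ K, c v * m v y := by
  have hK := h.sub hx
  have hK' := h.sub hx'
  have g := fun y hy => h.exists_blue_of_mem (y := y) hx hy hz hxz
  have g' := fun y hy => h.exists_blue_of_mem (y := y) hx' hy hz hxz'
  obtain ⟨c, hc⟩ : ∃ c : V → ℕ, ∀ v, c v =
      if v = x ∨ v = x' then 5 else if v ∈ R then 6 else 3 :=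
    ⟨_, fun _ => rfl⟩
  have hc3 : ∀ v, 3 ≤ c v := by grind
  refine ⟨c, ?_, h.weight_ok c (fun v _ => hc3 v) fun y a ha hay hy => ?_⟩
  · have e : ∀ v ∈ K, c v + ((if v = x then 1 else 0) + (if v = x' then 1 else 0)) =
        if v ∈ R then 6 else 3 := by
      grind
    have e' := Finset.sum_congr rfl e
    simp only [Finset.sum_add_distrib, h.sum_base, Finset.sum_ite_eq', hK, hK', if_true] at e'
    omega
  · by_cases haR : a ∈ R
    · by_cases hax : a = x
      · subst hax
        have := g y hy
        grind
      · by_cases hax' : a = x'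
        · subst hax'
          have := g' y hy
          grind
        · grind
    · have f₂ := h.exists_two_blue ha hy haR (hnp a (Finset.mem_sdiff.2 ⟨ha, haR⟩))
      have := h.sub
      grind

lemma exists_weight (h : IsExtremalPair m K R) (hcard : R.card + 2 ≤ K.card) :
    ∃ c : V → ℕ, ∑ v ∈ K, c v + 2 ≤ 3 * K.card + 3 * R.card ∧
      ∀ y, 12 ≤ ∑ v ∈ K, c v * m v y := by
  have hone : 1 < (K \ R).card := by
    rw [Finset.card_sdiff_of_subset h.sub]
    omega
  obtain ⟨s, hs, t, ht, hst⟩ := Finset.one_lt_card.1 hone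
  by_cases hpair : ∃ z ∈ K \ R, ∃ x ∈ R, ∀ v ∈ R, v ≠ x → m v z = 0
  · obtain ⟨z, hz, x, hx, hp⟩ := hpair
    by_cases hpair' : ∃ z' ∈ K \ R, z' ≠ z ∧ ∃ x ∈ R, ∀ v ∈ R, v ≠ x → m v z' = 0
    · obtain ⟨z', hz', hzz, x', hx', hp'⟩ := hpair'
      by_cases hxx : x = x'
      · subst hxx
        exact h.exists_weight_of_shared hx hz hz' hzz.symm hp hp'
      · exact h.exists_weight_of_disjoint hx hx' hz hz' hxx hzz.symm hp hp'
    · have hnp : ∀ t ∈ K \ R, t ≠ z → ¬ ∃ x ∈ R, ∀ v ∈ R, v ≠ x → m v t = 0 :=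
        fun t ht htz hex => hpair' ⟨t, ht, htz, hex⟩
      obtain ⟨z', hz', hzz⟩ : ∃ z' ∈ K \ R, z' ≠ z := by
        by_cases hsz : s = z
        · exact ⟨t, ht, fun e => hst (hsz.trans e.symm)⟩
        · exact ⟨s, hs, hsz⟩
      obtain ⟨v, hv, u, hu, hvu, hvz, huz⟩ := h.exists_two_blue_self hz' (hnp z' hz' hzz)
      by_cases hxv : x = v
      · exact h.exists_weight_of_single hx hu (hxv ▸ hvu) hz hz' hp huz hnp
      · exact h.exists_weight_of_single hx hv hxv hz hz' hp hvz hnp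
  · have hnp : ∀ t ∈ K \ R, ¬ ∃ x ∈ R, ∀ v ∈ R, v ≠ x → m v t = 0 :=
      fun t ht hex => hpair ⟨t, ht, hex⟩
    obtain ⟨v, hv, u, hu, hvu, hvz, huz⟩ := h.exists_two_blue_self hs (hnp s hs)
    exact h.exists_weight_of_none hv hu hvu hs hvz huz hnp

end IsExtremalPair

open Classical in
lemma exists_isExtremalPair [Finite V] {m : V → V → ℕ} (hs : ∀ x y, m x y = m y x)
    (h2 : ∀ x y, m x y ≤ 2) (h0 : ∀ x, m x x = 2) {K : Finset V} (hK : IsBlueClique m K)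
    (hmax : ∀ K', IsBlueClique m K' → K'.card ≤ K.card) :
    ∃ K' R, K'.card = K.card ∧ IsExtremalPair m K' R := by
  have := Fintype.ofFinite V
  let A : Finset (Finset V × Finset V) := Finset.univ.filter fun p =>
    p.2 ⊆ p.1 ∧ p.1.card = K.card ∧ IsBlueClique m p.1 ∧ IsRedClique m p.2
  have hA : A.Nonempty := ⟨(K, ∅), Finset.mem_filter.2
    ⟨Finset.mem_univ _, Finset.empty_subset _, rfl, hK, by simp [IsRedClique]⟩⟩
  obtain ⟨p, hpA, hp⟩ := A.exists_max_image (fun p => p.2.card) hA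
  obtain ⟨⟨L, R⟩, hLA, hL⟩ := (A.filter fun s => s.2.card = p.2.card).exists_min_image
    (fun s => crossMissing m s.1 s.2) ⟨p, by simp [hpA]⟩
  simp only [A, Finset.mem_filter, Finset.mem_univ, true_and] at hLA hL hp
  obtain ⟨⟨hsub, hcard, hblue, hred⟩, hRp⟩ := hLA
  exact ⟨L, R, hcard,
    { symm := hs
      le_two := h2
      self := h0
      sub := hsub
      blue := hblue
      red := hred
      card_le := fun K' hK' => hcard ▸ hmax K' hK'
      red_card_le := fun K' R' h1 h2 h3 h4 =>
        hRp ▸ hp (K', R') ⟨h1, h2.trans hcard, h3, h4⟩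
      cross_le := fun K' R' h1 h2 h3 h4 h5 =>
        hL (K', R') ⟨⟨h1, h2.trans hcard, h3, h4⟩, h5.trans hRp⟩ }⟩

omit [DecidableEq V] in
/-- Double counting: a vertex weighting of small total weight contradicts every vertex having
small missing degree. -/
lemma not_forall_le_weighted_sum [Fintype V] {m : V → V → ℕ} {K : Finset V} {c : V → ℕ} {T : ℕ}
    (hm : ∀ x, T * ∑ y, m x y < 12 * Fintype.card V) (hK : K.Nonempty) (hc : ∑ v ∈ K, c v ≤ T) :
    ¬ ∀ y, 12 ≤ ∑ v ∈ K, c v * m v y := by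
  intro hy
  obtain ⟨k, hk⟩ := hK
  have h1 : 12 * Fintype.card V ≤ ∑ v ∈ K, c v * ∑ y, m v y := by
    simp only [Finset.mul_sum]
    rw [Finset.sum_comm, mul_comm, ← smul_eq_mul, ← Finset.card_univ, ← Finset.sum_const]
    exact Finset.sum_le_sum fun y _ => hy y
  obtain ⟨v, hv, hcv⟩ : ∃ v ∈ K, 0 < c v := by
    by_contra! hne
    have := hy k
    rw [Finset.sum_eq_zero fun v hv => by rw [Nat.le_zero.1 (hne v hv), zero_mul]] at this
    omega
  have h2 : ∑ v ∈ K, c v * (T * ∑ y, m v y) < ∑ v ∈ K, c v * (12 * Fintype.card V) :=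
    Finset.sum_lt_sum (fun v _ => Nat.mul_le_mul_left _ (hm v).le)
      ⟨v, hv, Nat.mul_lt_mul_of_pos_left (hm v) hcv⟩
  have h3 : ∑ v ∈ K, c v * (T * ∑ y, m v y) = T * ∑ v ∈ K, c v * ∑ y, m v y := by
    rw [Finset.mul_sum]
    exact Finset.sum_congr rfl fun v _ => by ring
  rw [h3, ← Finset.sum_mul] at h2
  exact absurd (h2.trans_le (Nat.mul_le_mul_right _ hc)) (not_lt.2 (Nat.mul_le_mul_left _ h1))

variable {w : V → V → ℕ}

omit [DecidableEq V] in
lemma hasSub_BK (hG : IsColoured w) {m : ℕ} {K : Finset V}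
    (hK : IsBlueClique (fun x y => 2 - w x y) K) (hm : m ≤ K.card) : HasSub w (BK m) := by
  obtain ⟨L, hLK, rfl⟩ := Finset.exists_subset_card_eq hm
  refine ⟨fun i => (L.equivFin.symm i : V),
    Subtype.val_injective.comp L.equivFin.symm.injective, fun i j => ?_⟩
  unfold BK
  split_ifs with hij
  · exact Nat.zero_le _
  · have := hK _ (hLK (L.equivFin.symm i).2) _ (hLK (L.equivFin.symm j).2)
      fun e => hij (L.equivFin.symm.injective (Subtype.ext e))
    have := hG.2.1 (L.equivFin.symm i) (L.equivFin.symm j)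
    simp only at *
    omega

lemma hasSub_Gt {b q : ℕ} {K R : Finset V}
    (hK : IsBlueClique (fun x y => 2 - w x y) K) (hR : IsRedClique (fun x y => 2 - w x y) R)
    (hRK : R ⊆ K) (hq : K.card = q) (hb : b ≤ R.card) : HasSub w (Gt (q + b) b) := by
  obtain ⟨S, hSR, rfl⟩ := Finset.exists_subset_card_eq hb
  have hSK := hSR.trans hRK
  have hcard : q + S.card - S.card = S.card + (K \ S).card := by
    rw [Finset.card_sdiff_of_subset hSK, hq]
    have := Finset.card_le_card hSK
    omega
  let g : Fin S.card ⊕ Fin (K \ S).card → V :=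
    Sum.elim (fun i => (S.equivFin.symm i : V)) (fun i => ((K \ S).equivFin.symm i : V))
  have hg : Function.Injective g := by
    refine Function.Injective.sumElim (Subtype.val_injective.comp S.equivFin.symm.injective)
      (Subtype.val_injective.comp (K \ S).equivFin.symm.injective) fun i j e => ?_
    have h1 := (S.equivFin.symm i).2
    have h2 := ((K \ S).equivFin.symm j).2
    rw [← e] at h2
    exact (Finset.mem_sdiff.1 h2).2 h1
  have hgK : ∀ s, g s ∈ K := by
    rintro (i | i)
    · exact hSK (S.equivFin.symm i).2
    · exact (Finset.mem_sdiff.1 ((K \ S).equivFin.symm i).2).1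
  let e : Fin (q + S.card - S.card) ≃ Fin S.card ⊕ Fin (K \ S).card :=
    (finCongr hcard).trans finSumFinEquiv.symm
  have hgS : ∀ i : Fin (q + S.card - S.card), i.val < S.card → g (e i) ∈ S := by
    intro i hi
    have : e i = Sum.inl ⟨i.val, hi⟩ := by
      rw [← Equiv.eq_symm_apply]
      ext
      simp [e]
    rw [this]
    exact (S.equivFin.symm _).2
  refine ⟨g ∘ e, hg.comp e.injective, fun i j => ?_⟩
  unfold Gt
  have hne : i ≠ j → g (e i) ≠ g (e j) := fun hij h' => hij (e.injective (hg h'))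
  split_ifs with hij hlt
  · exact Nat.zero_le _
  · have := hR _ (hSR (hgS i hlt.1)) _ (hSR (hgS j hlt.2)) (hne hij)
    simp only [Function.comp_apply] at *
    omega
  · have := hK _ (hgK (e i)) _ (hgK (e j)) (hne hij)
    simp only [Function.comp_apply] at *
    omega

lemma exists_isBlueClique_of_hasSub_BK {q : ℕ} (h : HasSub w (BK q)) :
    ∃ K : Finset V, K.card = q ∧ IsBlueClique (fun x y => 2 - w x y) K := by
  obtain ⟨φ, hφ, hw⟩ := h
  refine ⟨Finset.univ.image φ, by rw [Finset.card_image_of_injective _ hφ, Finset.card_fin], ?_⟩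
  intro a ha b hb hab
  obtain ⟨i, -, rfl⟩ := Finset.mem_image.1 ha
  obtain ⟨j, -, rfl⟩ := Finset.mem_image.1 hb
  have := hw i j
  rw [BK, if_neg fun e => hab (congrArg φ e)] at this
  simp only
  omega

omit [DecidableEq V] in
lemma mul_sum_missing_lt [Fintype V] (hG : IsColoured w) {q b : ℕ} (hb : 1 ≤ b) (hq : b < q)
    {x : V} (hdeg : (2 - 12 / (3 * (q : ℝ) + 3 * (b : ℝ) - 5)) * (Fintype.card V : ℝ) <
      ∑ y : V, (w x y : ℝ)) :
    (3 * q + 3 * b - 5) * ∑ y, (2 - w x y) < 12 * Fintype.card V := by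
  obtain ⟨T, hT⟩ : ∃ T, 3 * q + 3 * b = T + 5 := ⟨3 * q + 3 * b - 5, by omega⟩
  have hT0 : 0 < T := by omega
  have hTr : 3 * (q : ℝ) + 3 * (b : ℝ) - 5 = T := by
    have : (3 * q + 3 * b : ℝ) = T + 5 := by exact_mod_cast hT
    linarith
  have hsum : ∑ y, (2 - w x y) + ∑ y, w x y = 2 * Fintype.card V := by
    rw [← Finset.sum_add_distrib, Finset.sum_congr rfl fun y _ => Nat.sub_add_cancel (hG.2.1 x y)]
    simp [mul_comm]
  have hsum' : ((∑ y, (2 - w x y) : ℕ) : ℝ) + ∑ y, (w x y : ℝ) = 2 * Fintype.card V := by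
    exact_mod_cast hsum
  rw [hTr] at hdeg
  have hT' : (0 : ℝ) < T := by exact_mod_cast hT0
  have h1 : ((∑ y, (2 - w x y) : ℕ) : ℝ) < 12 / T * Fintype.card V := by linarith
  rw [div_mul_eq_mul_div, lt_div_iff₀ hT'] at h1
  rw [hT, Nat.add_sub_cancel, mul_comm]
  exact_mod_cast h1

end BlueClique

/-- Lemma (excluding blue cliques): if `q > b ≥ 1` and a coloured graph on `n` vertices
with minimum degree greater than `(2 - 12/(3q+3b-5))·n` contains `BK_q`, then it contains
`BK_{q+1}` or `G_{q+b,b}`. -/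
theorem blue_clique_lemma {V : Type*} [Fintype V] (q b : ℕ) (hb : 1 ≤ b) (hq : b < q)
    (w : V → V → ℕ) (hG : IsColoured w)
    (hdeg : ∀ x : V,
      (2 - 12 / (3 * (q : ℝ) + 3 * (b : ℝ) - 5)) * (Fintype.card V : ℝ) < ∑ y : V, (w x y : ℝ))
    (hBK : HasSub w (BK q)) :
    HasSub w (BK (q + 1)) ∨ HasSub w (Gt (q + b) b) := by
  classical
  by_contra! hcon
  obtain ⟨hBK', hGt⟩ := hcon
  obtain ⟨K₀, hK₀, hblue⟩ := exists_isBlueClique_of_hasSub_BK hBK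
  obtain ⟨K, R, hKc, hE⟩ := exists_isExtremalPair (m := fun x y => 2 - w x y)
    (fun x y => by rw [hG.1]) (fun x y => Nat.sub_le _ _) (fun x => by rw [hG.2.2]) hblue
    fun K' hK' => by
      by_contra! hlt
      exact hBK' (hasSub_BK hG hK' (by omega))
  have hRb : R.card < b := by
    by_contra! hle
    exact hGt (hasSub_Gt hE.blue hE.red hE.sub (hKc.trans hK₀) hle)
  obtain ⟨c, hc, hy⟩ := hE.exists_weight (by omega)
  exact not_forall_le_weighted_sum (fun x => mul_sum_missing_lt hG hb hq (hdeg x))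
    (Finset.card_pos.1 (by omega)) (by omega) hy
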